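/- Fix T > 0 and let f : ℕ → (0,∞) be bounded with a positive lower bound. Define F(t,k) := log P_{T−t} f(k) and G(t,k) := e^{F(t,k+1) − F(t,k)} for t ∈ [0,T] and k ∈ ℕ, where P_s is the Poisson semigroup. Then for every k ∈ ℕ and every t ∈ (0,T), ∂_t G(t,k) = −G(t,k)·(G(t,k+1) − G(t,k)). -/

import Mathlib

/-- The Poisson measure on ℕ with intensity `t`: `π_t(n) = e^{-t} t^n / n!`. -/
noncomputable def poissonPMF (t : ℝ) (n : ℕ) : ℝ :=
  Real.exp (-t) * t ^ n / (Nat.factorial n)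

/-- The Poisson semigroup `P_t f(k) = Σ_{n∈ℕ} f(k+n) π_t(n)`. -/
noncomputable def poissonSemigroup (t : ℝ) (f : ℕ → ℝ) (k : ℕ) : ℝ :=
  ∑' n : ℕ, f (k + n) * poissonPMF t n

/-- A bounded exponential generating function may be differentiated term by term, which shifts
its coefficients. -/
theorem hasDerivAt_tsum_mul_pow_div_factorial {a : ℕ → ℝ} {M : ℝ} (ha : ∀ n, |a n| ≤ M) (s : ℝ) :
    HasDerivAt (fun x : ℝ => ∑' n : ℕ, a n * (x ^ n / n.factorial))
      (∑' n : ℕ, a (n + 1) * (s ^ n / n.factorial)) s := by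
  have hM : 0 ≤ M := (abs_nonneg _).trans (ha 0)
  set R : ℝ := |s| + 1
  have hR : 0 ≤ R := by positivity
  have hshift : ∀ (x : ℝ) (n : ℕ),
      ((n + 1 : ℕ) : ℝ) * x ^ n / (n + 1).factorial = x ^ n / n.factorial := by
    intro x n
    rw [Nat.factorial_succ, Nat.cast_mul]
    field_simp
  have hu : Summable fun n : ℕ => M * (n * R ^ (n - 1) / n.factorial) := by
    refine Summable.mul_left M ((summable_nat_add_iff 1).1 ?_)
    simpa only [Nat.add_sub_cancel, hshift] using Real.summable_pow_div_factorial R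
  have hbound : ∀ (n : ℕ) (y : ℝ), y ∈ Metric.ball (0 : ℝ) R →
      ‖a n * (n * y ^ (n - 1) / n.factorial)‖ ≤ M * (n * R ^ (n - 1) / n.factorial) := by
    intro n y hy
    have hy' : |y| ≤ R := by simpa using (mem_ball_zero_iff.1 hy).le
    rw [Real.norm_eq_abs, abs_mul, abs_div, abs_mul, abs_pow, Nat.abs_cast, Nat.abs_cast]
    gcongr
    exact ha n
  have hs : s ∈ Metric.ball (0 : ℝ) R := by simp [R]
  have hzero : Summable fun n : ℕ => a n * ((0 : ℝ) ^ n / n.factorial) :=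
    summable_of_ne_finset_zero (s := {0}) fun n hn => by
      simp [zero_pow (Finset.notMem_singleton.1 hn)]
  have hderiv := hasDerivAt_tsum_of_isPreconnected hu Metric.isOpen_ball
    (convex_ball (0 : ℝ) R).isPreconnected
    (fun n y _ => ((hasDerivAt_pow n y).div_const (n.factorial : ℝ)).const_mul (a n))
    hbound (Metric.mem_ball_self (by positivity)) hzero hs
  refine hderiv.congr_deriv ?_
  rw [(Summable.of_norm_bounded hu fun n => hbound n s hs).tsum_eq_zero_add]
  simp only [Nat.add_sub_cancel, hshift]
  simp

theorem poissonSemigroup_eq_exp_mul_tsum (t : ℝ) (f : ℕ → ℝ) (k : ℕ) :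
    poissonSemigroup t f k =
      Real.exp (-t) * ∑' n : ℕ, f (k + n) * (t ^ n / n.factorial) := by
  rw [poissonSemigroup, ← tsum_mul_left]
  congr 1 with n
  rw [poissonPMF]
  ring

/-- The generator of the Poisson semigroup is the discrete derivative. -/
theorem hasDerivAt_poissonSemigroup {f : ℕ → ℝ} {M : ℝ} (hf : ∀ n, |f n| ≤ M) (k : ℕ) (s : ℝ) :
    HasDerivAt (fun x => poissonSemigroup x f k)
      (poissonSemigroup s f (k + 1) - poissonSemigroup s f k) s := by
  simp only [poissonSemigroup_eq_exp_mul_tsum]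
  refine ((hasDerivAt_neg s).exp.fun_mul
    (hasDerivAt_tsum_mul_pow_div_factorial (fun n => hf (k + n)) s)).congr_deriv ?_
  simp only [add_assoc, add_comm 1]
  ring

theorem poissonSemigroup_pos {f : ℕ → ℝ} {M : ℝ} (hpos : ∀ n, 0 < f n) (hf : ∀ n, f n ≤ M)
    {t : ℝ} (ht : 0 ≤ t) (k : ℕ) : 0 < poissonSemigroup t f k := by
  rw [poissonSemigroup_eq_exp_mul_tsum]
  have hnonneg : ∀ n : ℕ, 0 ≤ f (k + n) * (t ^ n / n.factorial) := fun n =>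
    mul_nonneg (hpos _).le (by positivity)
  have hsum : Summable fun n : ℕ => f (k + n) * (t ^ n / n.factorial) :=
    Summable.of_nonneg_of_le hnonneg
      (fun n => mul_le_mul_of_nonneg_right (hf _) (by positivity))
      ((Real.summable_pow_div_factorial t).mul_left M)
  exact mul_pos (Real.exp_pos _) (hsum.tsum_pos hnonneg 0 (by simpa using hpos k))

/-- For `f` bounded above and below by positive constants, with
`F(t,k) := log P_{T−t} f(k)` and `G(t,k) := e^{F(t,k+1)−F(t,k)}`, one has
`∂_t G(t,k) = −G(t,k)·(G(t,k+1) − G(t,k))` for `t ∈ (0,T)`. -/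
theorem G_heat_equation (T : ℝ) (hT : 0 < T) (f : ℕ → ℝ) (m M : ℝ) (hm : 0 < m)
    (hbd : ∀ k, m ≤ f k ∧ f k ≤ M)
    (F : ℝ → ℕ → ℝ)
    (hF : ∀ t k, F t k = Real.log (poissonSemigroup (T - t) f k))
    (G : ℝ → ℕ → ℝ)
    (hG : ∀ t k, G t k = Real.exp (F t (k + 1) - F t k)) :
    ∀ k : ℕ, ∀ t ∈ Set.Ioo (0 : ℝ) T,
      HasDerivAt (fun s : ℝ => G s k) (-(G t k) * (G t (k + 1) - G t k)) t := by
  intro k t ht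
  have hpos : ∀ s ≤ T, ∀ j, 0 < poissonSemigroup (T - s) f j := fun s hs =>
    poissonSemigroup_pos (fun n => hm.trans_le (hbd n).1) (fun n => (hbd n).2) (sub_nonneg.2 hs)
  have hGquot : ∀ s ≤ T, ∀ j,
      G s j = poissonSemigroup (T - s) f (j + 1) / poissonSemigroup (T - s) f j := by
    intro s hs j
    rw [hG, hF, hF, Real.exp_sub, Real.exp_log (hpos s hs _), Real.exp_log (hpos s hs _)]
  have habs : ∀ n, |f n| ≤ M := fun n => by
    rw [abs_of_pos (hm.trans_le (hbd n).1)]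
    exact (hbd n).2
  have hderiv : ∀ j, HasDerivAt (fun s => poissonSemigroup (T - s) f j)
      (-(poissonSemigroup (T - t) f (j + 1) - poissonSemigroup (T - t) f j)) t := fun j =>
    (hasDerivAt_poissonSemigroup habs j (T - t)).comp_const_sub T t
  have hquot := (hderiv (k + 1)).fun_div (hderiv k) (hpos t ht.2.le k).ne'
  have heq : (fun s => G s k) =ᶠ[nhds t]
      fun s => poissonSemigroup (T - s) f (k + 1) / poissonSemigroup (T - s) f k := by
    filter_upwards [Iio_mem_nhds ht.2] with s hs using hGquot s hs.le k
  refine (hquot.congr_of_eventuallyEq heq).congr_deriv ?_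
  rw [hGquot t ht.2.le, hGquot t ht.2.le]
  have h0 := (hpos t ht.2.le k).ne'
  have h1 := (hpos t ht.2.le (k + 1)).ne'
  field_simp
  ring
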